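/- arXiv:math/0301007 — 2 statements merged into one kernel-verified Lean document; each statement's English description precedes it below -/
import Mathlib

section
/- For τ in the Siegel upper half space ℍ_3, set r₁(τ) = θ[0,0,0;0,0,0](τ)·θ[0,0,0;1,0,0](τ)·θ[0,0,0;0,1,0](τ)·θ[0,0,0;1,1,0](τ), r₂(τ) = θ[0,0,1;0,0,0](τ)·θ[0,0,1;1,0,0](τ)·θ[0,0,1;0,1,0](τ)·θ[0,0,1;1,1,0](τ), and r₃(τ) = θ[0,0,0;0,0,1](τ)·θ[0,0,0;1,0,1](τ)·θ[0,0,0;0,1,1](τ)·θ[0,0,0;1,1,1](τ). Then for every τ ∈ ℍ_3 one has r₁(τ)⁴ + r₂(τ)⁴ + r₃(τ)⁴ − 2r₁(τ)²r₂(τ)² − 2r₁(τ)²r₃(τ)² − 2r₂(τ)²r₃(τ)² = 0. In particular this is a polynomial relation among the squares of the theta constants. -/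
open scoped Matrix BigOperators
open Matrix

noncomputable section

/-- A complex `g × g` matrix lies in the Siegel upper half space `ℍ_g` iff it is
symmetric and its imaginary part is positive definite. -/
def IsSiegel {g : ℕ} (τ : Matrix (Fin g) (Fin g) ℂ) : Prop :=
  τ.IsSymm ∧ (Matrix.of fun i j => (τ i j).im).PosDef

/-- The theta constant `θ[ε;ε'](τ) = ∑_{m∈ℤ^g} exp[πi(ᵗ(m+ε/2)·τ·(m+ε/2) + ᵗ(m+ε/2)·ε')]`. -/
def thetaConst (g : ℕ) (ε ε' : Fin g → Fin 2) (τ : Matrix (Fin g) (Fin g) ℂ) : ℂ :=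
  ∑' m : Fin g → ℤ, Complex.exp ((Real.pi : ℂ) * Complex.I *
    ((∑ i, ∑ j, ((m i : ℂ) + ((ε i : ℕ) : ℂ) / 2) * τ i j * ((m j : ℂ) + ((ε j : ℕ) : ℂ) / 2)) +
      ∑ i, ((m i : ℂ) + ((ε i : ℕ) : ℂ) / 2) * ((ε' i : ℕ) : ℂ)))

/-- `r₁(τ) = θ[0,0,0;0,0,0]·θ[0,0,0;1,0,0]·θ[0,0,0;0,1,0]·θ[0,0,0;1,1,0]`. -/
def r₁ (τ : Matrix (Fin 3) (Fin 3) ℂ) : ℂ :=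
  thetaConst 3 ![0,0,0] ![0,0,0] τ * thetaConst 3 ![0,0,0] ![1,0,0] τ *
    thetaConst 3 ![0,0,0] ![0,1,0] τ * thetaConst 3 ![0,0,0] ![1,1,0] τ

/-- `r₂(τ) = θ[0,0,1;0,0,0]·θ[0,0,1;1,0,0]·θ[0,0,1;0,1,0]·θ[0,0,1;1,1,0]`. -/
def r₂ (τ : Matrix (Fin 3) (Fin 3) ℂ) : ℂ :=
  thetaConst 3 ![0,0,1] ![0,0,0] τ * thetaConst 3 ![0,0,1] ![1,0,0] τ *
    thetaConst 3 ![0,0,1] ![0,1,0] τ * thetaConst 3 ![0,0,1] ![1,1,0] τ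

/-- `r₃(τ) = θ[0,0,0;0,0,1]·θ[0,0,0;1,0,1]·θ[0,0,0;0,1,1]·θ[0,0,0;1,1,1]`. -/
def r₃ (τ : Matrix (Fin 3) (Fin 3) ℂ) : ℂ :=
  thetaConst 3 ![0,0,0] ![0,0,1] τ * thetaConst 3 ![0,0,0] ![1,0,1] τ *
    thetaConst 3 ![0,0,0] ![0,1,1] τ * thetaConst 3 ![0,0,0] ![1,1,1] τ

/-- The value `∑ vᵢ τᵢⱼ vⱼ` of the quadratic form attached to `τ`. -/
def quadValue {g : ℕ} (τ : Matrix (Fin g) (Fin g) ℂ) (v : Fin g → ℂ) : ℂ :=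
  ∑ i, ∑ j, v i * τ i j * v j

/-- The vector `m + a / 2` with complex entries. -/
def halfShift {g : ℕ} (a m : Fin g → ℤ) : Fin g → ℂ := fun i => (m i : ℂ) + (a i : ℂ) / 2

/-- The general term of the theta series with integral characteristic `[a; b]`. -/
def thetaTerm {g : ℕ} (τ : Matrix (Fin g) (Fin g) ℂ) (a b m : Fin g → ℤ) : ℂ :=
  Complex.exp ((Real.pi : ℂ) * Complex.I *
    (quadValue τ (halfShift a m) + ∑ i, halfShift a m i * (b i : ℂ)))

/-- The theta constant with integral characteristic `[a; b]`. -/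
def intTheta {g : ℕ} (τ : Matrix (Fin g) (Fin g) ℂ) (a b : Fin g → ℤ) : ℂ :=
  ∑' m, thetaTerm τ a b m

theorem thetaConst_eq_intTheta {g : ℕ} (ε ε' : Fin g → Fin 2) (τ : Matrix (Fin g) (Fin g) ℂ) :
    thetaConst g ε ε' τ =
      intTheta τ (fun i => ((ε i : ℕ) : ℤ)) (fun i => ((ε' i : ℕ) : ℤ)) := by
  simp [thetaConst, intTheta, thetaTerm, quadValue, halfShift]

theorem quadValue_neg {g : ℕ} (τ : Matrix (Fin g) (Fin g) ℂ) (v : Fin g → ℂ) :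
    quadValue τ (-v) = quadValue τ v := by
  simp [quadValue]

theorem quadValue_sub_add_quadValue_add {g : ℕ} (τ : Matrix (Fin g) (Fin g) ℂ)
    (v w : Fin g → ℂ) :
    quadValue τ (v - w) + quadValue τ (v + w) =
      quadValue ((2 : ℂ) • τ) v + quadValue ((2 : ℂ) • τ) w := by
  simp only [quadValue, ← Finset.sum_add_distrib]
  refine Finset.sum_congr rfl fun i _ => Finset.sum_congr rfl fun j _ => ?_
  simp only [Pi.add_apply, Pi.sub_apply, Matrix.smul_apply, smul_eq_mul]
  ring

theorem exp_pi_mul_I_mul_intCast_two_mul (n : ℤ) :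
    Complex.exp ((Real.pi : ℂ) * Complex.I * ((2 * n : ℤ) : ℂ)) = 1 := by
  rw [Complex.exp_eq_one_iff]
  exact ⟨n, by push_cast; ring⟩

theorem exp_pi_mul_I_mul_odd (n : ℤ) :
    Complex.exp ((Real.pi : ℂ) * Complex.I * ((2 * n + 1 : ℤ) : ℂ)) = -1 := by
  have h : (Real.pi : ℂ) * Complex.I * ((2 * n + 1 : ℤ) : ℂ) =
      (Real.pi : ℂ) * Complex.I * ((2 * n : ℤ) : ℂ) + (Real.pi : ℂ) * Complex.I := by
    push_cast; ring
  rw [h, Complex.exp_add, exp_pi_mul_I_mul_intCast_two_mul, Complex.exp_pi_mul_I, one_mul]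

theorem intTheta_add_two_mul {g : ℕ} (τ : Matrix (Fin g) (Fin g) ℂ) (a b c : Fin g → ℤ) :
    intTheta τ (a + 2 * c) b = intTheta τ a b := by
  rw [intTheta, intTheta, ← (Equiv.addRight c).tsum_eq (thetaTerm τ a b)]
  refine tsum_congr fun m => ?_
  have h : halfShift (a + 2 * c) m = halfShift a (Equiv.addRight c m) := by
    funext i
    simp [halfShift]
    ring
  simp only [thetaTerm, h]

/-- Theta constants with odd characteristic vanish. -/
theorem intTheta_eq_zero_of_odd {g : ℕ} (τ : Matrix (Fin g) (Fin g) ℂ) (a b : Fin g → ℤ)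
    (hab : Odd (∑ i, a i * b i)) : intTheta τ a b = 0 := by
  have key : ∀ m, thetaTerm τ a b ((Equiv.neg _).trans (Equiv.subRight a) m) =
      -thetaTerm τ a b m := by
    intro m
    have h : halfShift a ((Equiv.neg _).trans (Equiv.subRight a) m) = -halfShift a m := by
      funext i
      simp [halfShift]
      ring
    obtain ⟨k, hk⟩ := hab
    have hlin : ∑ i, (-halfShift a m) i * (b i : ℂ) = ∑ i, halfShift a m i * (b i : ℂ) +
        ((2 * (-(∑ i, m i * b i) - k - 1) + 1 : ℤ) : ℂ) := by
      have hs : ((2 * (-(∑ i, m i * b i) - k - 1) + 1 : ℤ) : ℂ) =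
          -2 * ∑ i, halfShift a m i * (b i : ℂ) := by
        have : 2 * (-(∑ i, m i * b i) - k - 1) + 1 =
            -(∑ i, (2 * m i + a i) * b i) := by
          simp only [add_mul, Finset.sum_add_distrib, mul_assoc, ← Finset.mul_sum, hk]
          ring
        rw [this]
        push_cast
        rw [Finset.mul_sum, ← Finset.sum_neg_distrib]
        refine Finset.sum_congr rfl fun i _ => ?_
        simp only [halfShift]
        ring
      rw [hs]
      simp only [Pi.neg_apply, neg_mul, Finset.sum_neg_distrib]
      ring
    rw [thetaTerm, h, quadValue_neg, hlin, ← add_assoc, mul_add, Complex.exp_add,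
      exp_pi_mul_I_mul_odd, thetaTerm, mul_neg_one]
  have h : intTheta τ a b = -intTheta τ a b := by
    conv_lhs => rw [intTheta, ← ((Equiv.neg _).trans (Equiv.subRight a)).tsum_eq]
    simp only [key, tsum_neg, intTheta]
  exact self_eq_neg.mp h

theorem summable_prod_pi_of_nonneg {g : ℕ} (f : Fin g → ℤ → ℝ) (hf : ∀ i, Summable (f i))
    (hf0 : ∀ i n, 0 ≤ f i n) : Summable fun m : Fin g → ℤ => ∏ i, f i (m i) := by
  induction g with
  | zero => exact Summable.of_finite
  | succ g ih =>
    rw [← (Fin.consEquiv fun _ : Fin (g + 1) => ℤ).summable_iff]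
    have := (hf 0).mul_of_nonneg (ih (fun i => f i.succ) (fun i => hf _) fun i => hf0 _)
      (hf0 0) fun m => Finset.prod_nonneg fun i _ => hf0 _ _
    refine this.congr fun x => ?_
    simp [Fin.prod_univ_succ, Fin.consEquiv]

theorem summable_exp_neg_sq_half_shift {c : ℝ} (hc : 0 < c) (a : ℤ) :
    Summable fun n : ℤ => Real.exp (-Real.pi * c * ((n : ℝ) + (a : ℝ) / 2) ^ 2) := by
  have h := ((summable_jacobiTheta₂_term_iff ((c * a / 2 : ℝ) * Complex.I)
    ((c : ℂ) * Complex.I)).mpr (by simpa using hc)).norm.mul_left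
      (Real.exp (-Real.pi * c * ((a : ℝ) / 2) ^ 2))
  refine h.congr fun n => ?_
  rw [norm_jacobiTheta₂_term, ← Real.exp_add, Complex.im_ofReal_mul, Complex.im_ofReal_mul,
    Complex.I_im]
  congr 1
  ring

/-- A positive definite quadratic form dominates a positive multiple of the sum of squares. -/
theorem Matrix.PosDef.exists_mul_sum_sq_le {g : ℕ} {Y : Matrix (Fin g) (Fin g) ℝ}
    (hY : Y.PosDef) :
    ∃ c > 0, ∀ v : Fin g → ℝ, c * ∑ i, v i ^ 2 ≤ ∑ i, ∑ j, v i * Y i j * v j := by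
  have hpos : ∀ v : Fin g → ℝ, v ≠ 0 → 0 < ∑ i, ∑ j, v i * Y i j * v j := by
    intro v hv
    have := (Matrix.posDef_iff_dotProduct_mulVec.mp hY).2 hv
    simpa [dotProduct, Matrix.mulVec, Finset.mul_sum, mul_assoc] using this
  have hcont : Continuous fun v : Fin g → ℝ => ∑ i, ∑ j, v i * Y i j * v j := by fun_prop
  rcases (Metric.sphere (0 : Fin g → ℝ) 1).eq_empty_or_nonempty with he | hne
  · refine ⟨1, one_pos, fun v => ?_⟩
    have hv : v = 0 := by
      by_contra hv
      have : ‖v‖⁻¹ • v ∈ Metric.sphere (0 : Fin g → ℝ) 1 := by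
        simp [norm_smul, hv]
      simp [he] at this
    simp [hv]
  obtain ⟨u, hu, hmin⟩ := (isCompact_sphere (0 : Fin g → ℝ) 1).exists_isMinOn hne
    hcont.continuousOn
  have hu0 : u ≠ 0 := by
    rintro rfl
    simp at hu
  set d := ∑ i, ∑ j, u i * Y i j * u j with hd
  have hd0 : 0 < d := hpos u hu0
  refine ⟨d / (g + 1), by positivity, fun v => ?_⟩
  have hnorm : d * ‖v‖ ^ 2 ≤ ∑ i, ∑ j, v i * Y i j * v j := by
    rcases eq_or_ne v 0 with rfl | hv
    · simp
    have hv' : ‖v‖ ≠ 0 := norm_ne_zero_iff.mpr hv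
    have hmem : ‖v‖⁻¹ • v ∈ Metric.sphere (0 : Fin g → ℝ) 1 := by
      simp [norm_smul, hv]
    have h1 : d ≤ ∑ i, ∑ j, (‖v‖⁻¹ • v) i * Y i j * (‖v‖⁻¹ • v) j := hmin hmem
    have h2 : ∑ i, ∑ j, (‖v‖⁻¹ • v) i * Y i j * (‖v‖⁻¹ • v) j =
        (‖v‖ ^ 2)⁻¹ * ∑ i, ∑ j, v i * Y i j * v j := by
      simp only [Finset.mul_sum, Pi.smul_apply, smul_eq_mul]
      refine Finset.sum_congr rfl fun i _ => Finset.sum_congr rfl fun j _ => ?_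
      ring
    rw [h2, inv_mul_eq_div, le_div_iff₀ (by positivity)] at h1
    exact h1
  have hsum : ∑ i, v i ^ 2 ≤ (g + 1) * ‖v‖ ^ 2 := by
    calc ∑ i, v i ^ 2 ≤ ∑ _i : Fin g, ‖v‖ ^ 2 := by
          refine Finset.sum_le_sum fun i _ => ?_
          rw [← sq_abs, ← Real.norm_eq_abs]
          gcongr
          exact norm_le_pi_norm v i
      _ = g * ‖v‖ ^ 2 := by simp
      _ ≤ (g + 1) * ‖v‖ ^ 2 := by gcongr; linarith
  calc d / (g + 1) * ∑ i, v i ^ 2 ≤ d / (g + 1) * ((g + 1) * ‖v‖ ^ 2) := by gcongr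
    _ = d * ‖v‖ ^ 2 := by field_simp
    _ ≤ _ := hnorm

theorem norm_thetaTerm {g : ℕ} (τ : Matrix (Fin g) (Fin g) ℂ) (a b m : Fin g → ℤ) :
    ‖thetaTerm τ a b m‖ = Real.exp (-Real.pi * ∑ i, ∑ j,
      ((m i : ℝ) + (a i : ℝ) / 2) * (τ i j).im * ((m j : ℝ) + (a j : ℝ) / 2)) := by
  have hv : ∀ i, halfShift a m i = (((m i : ℝ) + (a i : ℝ) / 2 : ℝ) : ℂ) := by
    intro i
    simp [halfShift]
  have hq : (quadValue τ (halfShift a m)).im = ∑ i, ∑ j,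
      ((m i : ℝ) + (a i : ℝ) / 2) * (τ i j).im * ((m j : ℝ) + (a j : ℝ) / 2) := by
    simp only [quadValue, Complex.im_sum, hv, Complex.im_mul_ofReal, Complex.im_ofReal_mul]
  have hl : (∑ i, halfShift a m i * (b i : ℂ)).im = 0 := by
    rw [Complex.im_sum]
    refine Finset.sum_eq_zero fun i _ => ?_
    rw [hv, Complex.im_ofReal_mul, Complex.intCast_im, mul_zero]
  rw [thetaTerm, Complex.norm_exp, mul_assoc, Complex.re_ofReal_mul, Complex.I_mul_re,
    Complex.add_im, hq, hl, add_zero, neg_mul, mul_neg]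

theorem summable_norm_thetaTerm {g : ℕ} {τ : Matrix (Fin g) (Fin g) ℂ} (hτ : IsSiegel τ)
    (a b : Fin g → ℤ) : Summable fun m => ‖thetaTerm τ a b m‖ := by
  obtain ⟨c, hc, hle⟩ := hτ.2.exists_mul_sum_sq_le
  refine (summable_prod_pi_of_nonneg _ (fun i => summable_exp_neg_sq_half_shift hc (a i))
    fun _ _ => (Real.exp_pos _).le).of_nonneg_of_le (fun _ => norm_nonneg _) fun m => ?_
  rw [norm_thetaTerm, ← Real.exp_sum, Real.exp_le_exp, ← Finset.mul_sum]
  have := mul_le_mul_of_nonneg_left (hle fun i => (m i : ℝ) + (a i : ℝ) / 2) Real.pi_pos.le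
  simp only [Matrix.of_apply] at this
  linarith

theorem IsSiegel.two_smul {g : ℕ} {τ : Matrix (Fin g) (Fin g) ℂ} (hτ : IsSiegel τ) :
    IsSiegel ((2 : ℂ) • τ) := by
  refine ⟨hτ.1.smul _, ?_⟩
  convert hτ.2.smul (two_pos : (0 : ℝ) < 2) using 1
  ext i j
  simp

/-- The bijection `(σ, p, q) ↦ (p - q - a, p + q + σ)`. -/
def duplicationEquiv {g : ℕ} (a : Fin g → ℤ) :
    (Fin g → Fin 2) × ((Fin g → ℤ) × (Fin g → ℤ)) ≃ (Fin g → ℤ) × (Fin g → ℤ) where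
  toFun x := (fun i => x.2.1 i - x.2.2 i - a i,
    fun i => x.2.1 i + x.2.2 i + ((x.1 i : ℕ) : ℤ))
  invFun y := (fun i => ⟨((y.1 i + y.2 i + a i) % 2).toNat, by omega⟩,
    (fun i => (y.1 i + y.2 i + a i) / 2,
      fun i => y.2 i - (y.1 i + y.2 i + a i) / 2 - (y.1 i + y.2 i + a i) % 2))
  left_inv x := by
    obtain ⟨s, p, q⟩ := x
    refine Prod.ext ?_ (Prod.ext ?_ ?_)
    · funext i
      apply Fin.ext
      have := (s i).isLt
      dsimp only
      omega
    all_goals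
      funext i
      have := (s i).isLt
      dsimp only
      omega
  right_inv y := by
    obtain ⟨m, n⟩ := y
    refine Prod.ext ?_ ?_ <;> funext i <;> dsimp only <;> omega

/-- The duplication formula for products of theta constants. -/
theorem intTheta_mul_intTheta {g : ℕ} {τ : Matrix (Fin g) (Fin g) ℂ} (hτ : IsSiegel τ)
    (a b c : Fin g → ℤ) :
    intTheta τ a b * intTheta τ a (b + c) = ∑ σ : Fin g → Fin 2,
      Complex.exp ((Real.pi : ℂ) * Complex.I * ∑ i, ((σ i : ℕ) : ℂ) * (b i : ℂ)) *
        (intTheta ((2 : ℂ) • τ) (fun i => ((σ i : ℕ) : ℤ)) c *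
          intTheta ((2 : ℂ) • τ) ((fun i => ((σ i : ℕ) : ℤ)) + a) c) := by
  have h1 := summable_norm_thetaTerm hτ a b
  have h2 := summable_norm_thetaTerm hτ a (b + c)
  have key : ∀ σ p q, thetaTerm τ a b (duplicationEquiv a (σ, p, q)).1 *
      thetaTerm τ a (b + c) (duplicationEquiv a (σ, p, q)).2 =
      Complex.exp ((Real.pi : ℂ) * Complex.I * ∑ i, ((σ i : ℕ) : ℂ) * (b i : ℂ)) *
        (thetaTerm ((2 : ℂ) • τ) (fun i => ((σ i : ℕ) : ℤ)) c p *
          thetaTerm ((2 : ℂ) • τ) ((fun i => ((σ i : ℕ) : ℤ)) + a) c q) := by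
    intro σ p q
    set v := halfShift (fun i => ((σ i : ℕ) : ℤ)) p with hv
    set w := halfShift ((fun i => ((σ i : ℕ) : ℤ)) + a) q with hw
    have hm : halfShift a (duplicationEquiv a (σ, p, q)).1 = v - w := by
      funext i
      simp [hv, hw, halfShift, duplicationEquiv]
      ring
    have hn : halfShift a (duplicationEquiv a (σ, p, q)).2 = v + w := by
      funext i
      simp [hv, hw, halfShift, duplicationEquiv]
      ring
    have hlin : ∑ i, (v - w) i * (b i : ℂ) + ∑ i, (v + w) i * ((b + c) i : ℤ) =
        ((2 * ∑ i, p i * b i : ℤ) : ℂ) + ∑ i, ((σ i : ℕ) : ℂ) * (b i : ℂ) +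
          (∑ i, v i * (c i : ℂ) + ∑ i, w i * (c i : ℂ)) := by
      push_cast
      simp only [Finset.mul_sum, ← Finset.sum_add_distrib]
      refine Finset.sum_congr rfl fun i _ => ?_
      simp [hv, hw, halfShift]
      ring
    rw [thetaTerm, thetaTerm, thetaTerm, thetaTerm, hm, hn, ← Complex.exp_add, ← mul_add,
      add_add_add_comm, quadValue_sub_add_quadValue_add, hlin, ← Complex.exp_add,
      ← Complex.exp_add, ← one_mul (Complex.exp (_ + _)),
      ← exp_pi_mul_I_mul_intCast_two_mul (∑ i, p i * b i), ← Complex.exp_add]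
    congr 1
    ring
  have hsum : Summable fun x => thetaTerm τ a b (duplicationEquiv a x).1 *
      thetaTerm τ a (b + c) (duplicationEquiv a x).2 :=
    (duplicationEquiv a).summable_iff.mpr (summable_mul_of_summable_norm h1 h2)
  rw [intTheta, intTheta, tsum_mul_tsum_of_summable_norm h1 h2,
    ← (duplicationEquiv a).tsum_eq, hsum.tsum_prod, tsum_fintype]
  refine Finset.sum_congr rfl fun σ _ => ?_
  simp only [key]
  rw [tsum_mul_left, intTheta, intTheta, tsum_mul_tsum_of_summable_norm
    (summable_norm_thetaTerm hτ.two_smul _ _) (summable_norm_thetaTerm hτ.two_smul _ _)]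

theorem sum_fin_three_arrow_fin_two (f : (Fin 3 → Fin 2) → ℂ) :
    ∑ σ, f σ = f ![0,0,0] + f ![0,0,1] + f ![0,1,0] + f ![0,1,1] +
      (f ![1,0,0] + f ![1,0,1] + f ![1,1,0] + f ![1,1,1]) := by
  have h : (Finset.univ : Finset (Fin 3 → Fin 2)) =
      {![0,0,0], ![0,0,1], ![0,1,0], ![0,1,1], ![1,0,0], ![1,0,1], ![1,1,0], ![1,1,1]} := by
    decide
  rw [h]
  repeat rw [Finset.sum_insert (by decide)]
  rw [Finset.sum_singleton]
  ring

theorem exp_pi_mul_I_mul_natCast (n : ℕ) :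
    Complex.exp ((Real.pi : ℂ) * Complex.I * (n : ℂ)) = (-1) ^ n := by
  rw [mul_comm, Complex.exp_nat_mul, Complex.exp_pi_mul_I]

theorem thetaConst_pair {τ : Matrix (Fin 3) (Fin 3) ℂ} (hτ : IsSiegel τ) (e b₁ b₂ : Fin 2) :
    thetaConst 3 ![0,0,e] ![0,b₁,b₂] τ * thetaConst 3 ![0,0,e] ![1,b₁,b₂] τ =
      ∑ s : Fin 2, ∑ t : Fin 2, (-1) ^ ((s : ℕ) * b₁ + (t : ℕ) * b₂) *
        (thetaConst 3 ![0,s,t] ![1,0,0] ((2 : ℂ) • τ) *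
          thetaConst 3 ![0,s,t + e] ![1,0,0] ((2 : ℂ) • τ)) := by
  have hc : (fun i => (((![1,b₁,b₂] : Fin 3 → Fin 2) i : ℕ) : ℤ)) =
      (fun i => (((![0,b₁,b₂] : Fin 3 → Fin 2) i : ℕ) : ℤ)) +
        fun i => (((![1,0,0] : Fin 3 → Fin 2) i : ℕ) : ℤ) := by
    funext i
    fin_cases i <;> simp
  have hodd : ∀ s t : Fin 2, thetaConst 3 ![1,s,t] ![1,0,0] ((2 : ℂ) • τ) = 0 := by
    intro s t
    rw [thetaConst_eq_intTheta]
    exact intTheta_eq_zero_of_odd _ _ _ (by simp [Fin.sum_univ_three])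
  have hshift : ∀ s t : Fin 2, intTheta ((2 : ℂ) • τ)
      ((fun i => (((![0,s,t] : Fin 3 → Fin 2) i : ℕ) : ℤ)) +
        fun i => (((![0,0,e] : Fin 3 → Fin 2) i : ℕ) : ℤ))
      (fun i => (((![1,0,0] : Fin 3 → Fin 2) i : ℕ) : ℤ)) =
      thetaConst 3 ![0,s,t + e] ![1,0,0] ((2 : ℂ) • τ) := by
    intro s t
    rw [thetaConst_eq_intTheta,
      ← intTheta_add_two_mul _ (fun i => (((![0,s,t + e] : Fin 3 → Fin 2) i : ℕ) : ℤ)) _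
        ![0, 0, ((t : ℕ) * (e : ℕ) : ℤ)]]
    congr 1
    funext i
    fin_cases i
    · simp
    · simp
    · fin_cases t <;> fin_cases e <;> simp
  have hexp : ∀ σ : Fin 3 → Fin 2, Complex.exp ((Real.pi : ℂ) * Complex.I *
      ∑ i, ((σ i : ℕ) : ℂ) * ((((![0,b₁,b₂] : Fin 3 → Fin 2) i : ℕ) : ℤ) : ℂ)) =
      (-1) ^ ((σ 1 : ℕ) * (b₁ : ℕ) + (σ 2 : ℕ) * (b₂ : ℕ)) := by
    intro σ
    rw [← exp_pi_mul_I_mul_natCast]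
    simp [Fin.sum_univ_three]
  rw [thetaConst_eq_intTheta, thetaConst_eq_intTheta, hc, intTheta_mul_intTheta hτ,
    sum_fin_three_arrow_fin_two]
  simp only [hexp, ← thetaConst_eq_intTheta, hodd, hshift, Fin.sum_univ_two]
  simp
  ring

/-- Riemann's relation between the products `r₁`, `r₂` and `r₃`. -/
theorem r₁_eq_r₂_add_r₃ {τ : Matrix (Fin 3) (Fin 3) ℂ} (hτ : IsSiegel τ) :
    r₁ τ = r₂ τ + r₃ τ := by
  have h := thetaConst_pair hτ
  have h₁ := h 0 0 0
  have h₂ := h 0 1 0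
  have h₃ := h 1 0 0
  have h₄ := h 1 1 0
  have h₅ := h 0 0 1
  have h₆ := h 0 1 1
  simp only [Fin.sum_univ_two, Fin.isValue, Fin.val_zero, Fin.val_one, mul_zero,
    mul_one, add_zero, zero_add, pow_zero, pow_one, Fin.reduceAdd, one_mul] at h₁ h₂ h₃ h₄ h₅ h₆
  rw [r₁, r₂, r₃, mul_assoc, mul_assoc (_ * _), mul_assoc (_ * _), h₁, h₂, h₃, h₄, h₅, h₆]
  ring

/-- The induced polynomial relation among the squares of the genus 3 theta constants:
`r₁⁴ + r₂⁴ + r₃⁴ − 2r₁²r₂² − 2r₁²r₃² − 2r₂²r₃² = 0` on `ℍ_3`. -/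
theorem genus_three_theta_square_relation (τ : Matrix (Fin 3) (Fin 3) ℂ) (hτ : IsSiegel τ) :
    r₁ τ ^ 4 + r₂ τ ^ 4 + r₃ τ ^ 4 - 2 * r₁ τ ^ 2 * r₂ τ ^ 2 - 2 * r₁ τ ^ 2 * r₃ τ ^ 2 -
      2 * r₂ τ ^ 2 * r₃ τ ^ 2 = 0 := by
  rw [r₁_eq_r₂_add_r₃ hτ]
  ring
end
end

section
/- The Schottky–Igusa form F(τ) = θ^{(4)}_{S(8)⊕S(8)}(τ) − θ^{(4)}_{S(16)}(τ) is not identically zero on the Siegel upper half space ℍ_4: there exists τ ∈ ℍ_4 with F(τ) ≠ 0. -/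
open scoped Matrix BigOperators
open Matrix

noncomputable section

/-- The standard Gram matrix `S(8)` of the E₈ root lattice: the (symmetric) Cartan
matrix of E₈, i.e. `2` on the diagonal and `−1` exactly at the pairs of indices joined
by an edge of the E₈ Dynkin diagram (a chain `0—1—2—3—4—5—6` with the node `7`
attached to node `2`).  It is even, positive definite, of determinant `1`. -/
def E8Gram : Matrix (Fin 8) (Fin 8) ℤ := fun i j =>
  if i = j then 2
  else if (i.val, j.val) ∈ ([(0,1),(1,2),(2,3),(3,4),(4,5),(5,6),(2,7)] : List (ℕ × ℕ)) ∨
      (j.val, i.val) ∈ ([(0,1),(1,2),(2,3),(3,4),(4,5),(5,6),(2,7)] : List (ℕ × ℕ))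
    then -1 else 0

/-- The `16 × 16` block diagonal matrix `S(8) ⊕ S(8)`. -/
def E8E8Gram : Matrix (Fin 16) (Fin 16) ℤ :=
  Matrix.reindex finSumFinEquiv finSumFinEquiv (Matrix.fromBlocks E8Gram 0 0 E8Gram)

/-- The standard Gram matrix `S(16)` of the lattice `D₁₆⁺ = D₁₆ ∪ (D₁₆ + s)`,
`s = (1/2,…,1/2)`, with respect to the basis `2e₁, e₂−e₁, …, e₁₅−e₁₄, s`.
It is even, positive definite, of determinant `1`. -/
def D16plusGram : Matrix (Fin 16) (Fin 16) ℤ := fun i j =>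
  if i = j then (if i = 0 ∨ i = 15 then 4 else 2)
  else if (i = 0 ∧ j = 15) ∨ (i = 15 ∧ j = 0) then 1
  else if i.val + 1 = j.val ∨ j.val + 1 = i.val then
    (if i = 0 ∨ j = 0 then -2 else if i = 15 ∨ j = 15 then 0 else -1)
  else 0
/-- The genus `g` theta series of an integral quadratic form `S`:
`θ_S^{(g)}(τ) = ∑_{G ∈ Mat(m,g;ℤ)} exp[πi·Tr(ᵗG·S·G·τ)]`. -/
def quadThetaSeries (m g : ℕ) (S : Matrix (Fin m) (Fin m) ℤ)
    (τ : Matrix (Fin g) (Fin g) ℂ) : ℂ :=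
  ∑' G : Matrix (Fin m) (Fin g) ℤ,
    Complex.exp ((Real.pi : ℂ) * Complex.I *
      Matrix.trace ((G.map (Int.cast : ℤ → ℂ))ᵀ * S.map (Int.cast : ℤ → ℂ) *
        G.map (Int.cast : ℤ → ℂ) * τ))


/-- Positive roots, each written as the decimal number whose digits are its coordinates. -/
def e8PosCodes : List ℤ :=
 [1, 10, 11, 100, 110, 111, 1000, 1100, 1110, 1111, 10000, 11000, 11100, 11110, 11111, 100000,
  110000, 111000, 111100, 111110, 111111, 1000000, 1100000, 1110000, 1111000, 1111100, 1111110,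
  1111111, 10000000, 10000100, 10000110, 10000111, 10001100, 10001110, 10001111, 10001210,
  10001211, 10001221, 10011100, 10011110, 10011111, 10011210, 10011211, 10011221, 10012210,
  10012211, 10012221, 10012321, 10111100, 10111110, 10111111, 10111210, 10111211, 10111221,
  10112210, 10112211, 10112221, 10112321, 10122210, 10122211, 10122221, 10122321, 10123321,
  11111100, 11111110, 11111111, 11111210, 11111211, 11111221, 11112210, 11112211, 11112221,
  11112321, 11122210, 11122211, 11122221, 11122321, 11123321, 11222210, 11222211, 11222221,
  11222321, 11223321, 11233321, 20012321, 20112321, 20122321, 20123321, 20123421, 20123431,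
  20123432, 21112321, 21122321, 21123321, 21123421, 21123431, 21123432, 21222321, 21223321,
  21223421, 21223431, 21223432, 21233321, 21233421, 21233431, 21233432, 21234421, 21234431,
  21234432, 21234531, 21234532, 21234542, 31234531, 31234532, 31234542, 31234642, 31235642,
  31245642, 31345642, 32345642]

/-- All roots of `E₈`, encoded as in `e8PosCodes`. -/
def e8RootCodes : List ℤ := e8PosCodes ++ e8PosCodes.map Neg.neg

/-- The coordinates of a root of `E₈` given by its code. -/
def e8Vec (n : ℤ) : Fin 8 → ℤ := fun i => (n.tdiv (10 ^ (i : ℕ))).tmod 10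

/-- The bit mask of the parities of the inner products with the simple roots. -/
def e8Mask (n : ℤ) : ℕ := ∑ i : Fin 8, 2 ^ (i : ℕ) * ((E8Gram *ᵥ e8Vec n) i % 2).toNat

theorem nodup_e8RootCodes : e8RootCodes.Nodup := by decide +kernel

theorem sum_pow_mul_e8Vec : ∀ n ∈ e8RootCodes, ∑ i : Fin 8, 10 ^ (i : ℕ) * e8Vec n i = n := by
  decide +kernel

theorem norm_e8Vec : ∀ n ∈ e8RootCodes, e8Vec n ⬝ᵥ E8Gram *ᵥ e8Vec n = 2 := by
  decide +kernel

theorem mask_e8Vec : ∀ n ∈ e8RootCodes, ∀ i : Fin 8,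
    (E8Gram *ᵥ e8Vec n) i % 2 = if (e8Mask n).testBit i then 1 else 0 := by
  decide +kernel

/-- The masks of the positive roots, precomputed. -/
def e8PosMasks : List ℕ := [
  2, 5, 7, 138, 143, 141, 20, 158, 155, 153, 40, 60, 182, 179, 177, 80, 120, 108, 230, 227, 225,
  32, 112, 88, 76, 198, 195, 193, 4, 142, 139, 137, 154, 159, 157, 21, 23, 18, 178, 183, 181, 61,
  63, 58, 41, 43, 46, 164, 226, 231, 229, 109, 111, 106, 121, 123, 126, 244, 81, 83, 86, 220, 200,
  194, 199, 197, 77, 79, 74, 89, 91, 94, 212, 113, 115, 118, 252, 232, 33, 35, 38, 172, 184, 144,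
  160, 240, 216, 204, 70, 67, 65, 208, 248, 236, 102, 99, 97, 168, 188, 54, 51, 49, 148, 30, 27,
  25, 10, 15, 13, 133, 135, 130, 129, 131, 134, 12, 24, 48, 96, 64
]

theorem map_e8Mask : e8RootCodes.map e8Mask = e8PosMasks ++ e8PosMasks := by decide +kernel

/-- The parity of the number of ones among the eight binary digits of `x`. -/
def bitParity (x : ℕ) : ℕ :=
  let y := x ^^^ (x >>> 4)
  let z := y ^^^ (y >>> 2)
  (z ^^^ (z >>> 1)) % 2

theorem bitParity_eq : ∀ x < 256, bitParity x = (∑ i : Fin 8, (x.testBit i).toNat) % 2 := by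
  decide +kernel

def bits8 (w : ℕ) : Fin 8 → ℤ := fun i => if w.testBit i then 1 else 0

def charSum8 (w : ℕ) : ℤ := (e8PosMasks.map fun m =>
  if bitParity (m &&& w) = 0 then 1 else -1).sum

theorem charSum8_ge : ∀ w < 256, -8 ≤ charSum8 w := by decide +kernel

theorem charSum8_eq : ∀ w < 256, (bits8 w ⬝ᵥ E8Gram *ᵥ bits8 w) % 4 = 2 → charSum8 w = 8 := by
  decide +kernel

/-- The sign `(-1) ^ z` as an integer. -/
def intSign (z : ℤ) : ℤ := z.negOnePow

theorem intSign_add (a b : ℤ) : intSign (a + b) = intSign a * intSign b := by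
  simp [intSign, Int.negOnePow_add]

theorem intSign_eq_ite (z : ℤ) : intSign z = if Even z then 1 else -1 := by
  unfold intSign
  split_ifs with h
  · simp [Int.negOnePow_even z h]
  · simp [Int.negOnePow_odd z (Int.not_even_iff_odd.1 h)]

@[irreducible]
def e8Roots : Finset ℤ := e8RootCodes.toFinset

theorem mem_e8Roots {n : ℤ} : n ∈ e8Roots ↔ n ∈ e8RootCodes := by
  rw [e8Roots, List.mem_toFinset]

theorem e8Gram_transpose : E8Gramᵀ = E8Gram := by decide +kernel

theorem e8Gram_comm (x y : Fin 8 → ℤ) : x ⬝ᵥ E8Gram *ᵥ y = y ⬝ᵥ E8Gram *ᵥ x := by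
  rw [Matrix.dotProduct_mulVec, ← Matrix.mulVec_transpose, e8Gram_transpose, dotProduct_comm]

theorem e8Mask_lt : ∀ n ∈ e8RootCodes, e8Mask n < 256 := by
  have h : ∀ m ∈ e8PosMasks, m < 256 := by decide
  intro n hn
  have : e8Mask n ∈ e8RootCodes.map e8Mask := List.mem_map_of_mem hn
  rw [map_e8Mask] at this
  exact h _ (by simpa using this)

theorem bitParity_eq_zero_iff {n : ℤ} (hn : n ∈ e8RootCodes) (w : ℕ) :
    bitParity (e8Mask n &&& w) = 0 ↔ Even (e8Vec n ⬝ᵥ E8Gram *ᵥ bits8 w) := by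
  rw [bitParity_eq _ (lt_of_le_of_lt Nat.and_le_left (e8Mask_lt n hn)), e8Gram_comm, Int.even_iff,
    dotProduct, Finset.sum_int_mod]
  have : ∀ i : Fin 8, bits8 w i * (E8Gram *ᵥ e8Vec n) i % 2 =
      (((e8Mask n &&& w).testBit i).toNat : ℤ) := by
    intro i
    have h := mask_e8Vec n hn i
    rw [Int.mul_emod, h]
    cases hm : (e8Mask n).testBit i <;> cases hw : w.testBit i <;> simp [bits8, hm, hw]
  simp only [this]
  norm_cast

theorem charSum8_bits (w : ℕ) :
    ∑ n ∈ e8Roots, intSign (e8Vec n ⬝ᵥ E8Gram *ᵥ bits8 w) = 2 * charSum8 w := by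
  rw [e8Roots, List.sum_toFinset _ nodup_e8RootCodes]
  have : e8RootCodes.map (fun n => intSign (e8Vec n ⬝ᵥ E8Gram *ᵥ bits8 w)) =
      (e8RootCodes.map e8Mask).map fun m => if bitParity (m &&& w) = 0 then 1 else -1 := by
    rw [List.map_map]
    refine List.map_congr_left fun n hn => ?_
    simp [intSign_eq_ite, ← bitParity_eq_zero_iff hn]
  rw [this, map_e8Mask, List.map_append, List.sum_append, charSum8, two_mul]

theorem exists_bits8 (w : Fin 8 → ℤ) : ∃ k < 256, ∃ z, w = bits8 k + (2 : ℤ) • z := by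
  refine ⟨Nat.ofBits fun i : Fin 8 => w i % 2 = 1, Nat.ofBits_lt_two_pow _, fun i => w i / 2, ?_⟩
  ext i
  simp only [bits8, Pi.add_apply, Pi.smul_apply, smul_eq_mul, Nat.testBit_ofBits_lt _ _ i.2,
    decide_eq_true_eq, Fin.eta]
  split_ifs <;> omega

theorem e8_charSum (w : Fin 8 → ℤ) :
    -16 ≤ ∑ n ∈ e8Roots, intSign (e8Vec n ⬝ᵥ E8Gram *ᵥ w) ∧
    ((w ⬝ᵥ E8Gram *ᵥ w) % 4 = 2 →
      ∑ n ∈ e8Roots, intSign (e8Vec n ⬝ᵥ E8Gram *ᵥ w) = 16) := by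
  obtain ⟨k, hk, z, rfl⟩ := exists_bits8 w
  have h1 : ∀ n, intSign (e8Vec n ⬝ᵥ E8Gram *ᵥ (bits8 k + (2 : ℤ) • z)) =
      intSign (e8Vec n ⬝ᵥ E8Gram *ᵥ bits8 k) := by
    intro n
    rw [Matrix.mulVec_add, Matrix.mulVec_smul, dotProduct_add, dotProduct_smul, intSign_add,
      intSign_eq_ite ((2 : ℤ) • _), if_pos (by simp), mul_one]
  simp only [h1, charSum8_bits]
  refine ⟨by linarith [charSum8_ge k hk], fun h => ?_⟩
  rw [charSum8_eq k hk]
  · norm_num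
  simp only [Matrix.mulVec_add, Matrix.mulVec_smul, dotProduct_add, add_dotProduct,
    smul_dotProduct, dotProduct_smul, smul_eq_mul] at h
  rw [e8Gram_comm z] at h
  omega

theorem Finset.card_mul_le_card_filter_product {α β : Type*} [DecidableEq α] [DecidableEq β]
    {s : Finset α} {t : Finset β} {P : α → β → Prop} [∀ a, DecidablePred (P a)] {k : ℕ}
    (h : ∀ a ∈ s, k ≤ (t.filter (P a)).card) :
    s.card * k ≤ ((s ×ˢ t).filter fun x => P x.1 x.2).card := by
  rw [Finset.card_filter, Finset.sum_product, ← smul_eq_mul]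
  refine Finset.card_nsmul_le_sum _ _ _ fun a ha => ?_
  rw [← Finset.card_filter]
  exact h a ha

/-- The inner product of two roots given by their codes. -/
def e8Inner (m n : ℤ) : ℤ := e8Vec m ⬝ᵥ E8Gram *ᵥ e8Vec n

theorem e8Inner_comm (m n : ℤ) : e8Inner m n = e8Inner n m := e8Gram_comm _ _

theorem e8Inner_self {n : ℤ} (hn : n ∈ e8Roots) : e8Inner n n = 2 :=
  norm_e8Vec n (mem_e8Roots.1 hn)

theorem card_e8Roots : e8Roots.card = 240 := by
  rw [e8Roots, List.toFinset_card_of_nodup nodup_e8RootCodes]; rfl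

theorem sum_e8Roots_one : ∑ _n ∈ e8Roots, (1 : ℤ) = 240 := by
  rw [Finset.sum_const, card_e8Roots]; norm_num

theorem one_sub_intSign (z : ℤ) : 1 - intSign z = if Odd z then 2 else 0 := by
  simp only [intSign_eq_ite, ← Int.not_even_iff_odd]; split_ifs <;> simp_all

theorem one_add_intSign (z : ℤ) : 1 + intSign z = if Even z then 2 else 0 := by
  rw [intSign_eq_ite]; split_ifs <;> simp

theorem card_e8Roots_odd {a : ℤ} (ha : a ∈ e8Roots) :
    112 ≤ (e8Roots.filter fun n => Odd (e8Inner n a)).card := by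
  have h : (2 : ℤ) * (e8Roots.filter fun n => Odd (e8Inner n a)).card =
      ∑ n ∈ e8Roots, (1 - intSign (e8Inner n a)) := by
    simp only [one_sub_intSign, Finset.card_filter, Nat.cast_sum, Finset.mul_sum]
    exact Finset.sum_congr rfl fun n _ => by split_ifs <;> simp
  have h0 := (e8_charSum (e8Vec a)).2 (by have := e8Inner_self ha; unfold e8Inner at this; omega)
  simp only [Finset.sum_sub_distrib, sum_e8Roots_one, e8Inner, h0] at h
  simp only [e8Inner]
  omega

theorem e8_charSum_add {a b : ℤ} (ha : a ∈ e8Roots) (hb : b ∈ e8Roots) (hab : Odd (e8Inner a b)) :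
    ∑ n ∈ e8Roots, intSign (e8Inner n a) * intSign (e8Inner n b) = 16 := by
  rw [← (e8_charSum (e8Vec a + e8Vec b)).2]
  · simp [Matrix.mulVec_add, intSign_add, e8Inner]
  · have h1 := e8Inner_self ha
    have h2 := e8Inner_self hb
    have h3 := e8Inner_comm a b
    unfold e8Inner at *
    obtain ⟨k, hk⟩ := hab
    simp only [Matrix.mulVec_add, dotProduct_add, add_dotProduct]
    omega

theorem e8_charSum_self {a : ℤ} (ha : a ∈ e8Roots) :
    ∑ n ∈ e8Roots, intSign (e8Inner n a) = 16 :=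
  (e8_charSum (e8Vec a)).2 (by have := e8Inner_self ha; unfold e8Inner at this; omega)

theorem card_e8Roots_odd_even {a b : ℤ} (ha : a ∈ e8Roots) (hb : b ∈ e8Roots)
    (hab : Odd (e8Inner b a)) :
    56 ≤ (e8Roots.filter fun n => Odd (e8Inner n a) ∧ Even (e8Inner n b)).card := by
  have h : (4 : ℤ) * (e8Roots.filter fun n => Odd (e8Inner n a) ∧ Even (e8Inner n b)).card =
      ∑ n ∈ e8Roots, (1 - intSign (e8Inner n a)) * (1 + intSign (e8Inner n b)) := by
    simp only [one_sub_intSign, one_add_intSign, Finset.card_filter, Nat.cast_sum, Finset.mul_sum]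
    exact Finset.sum_congr rfl fun n _ => by split_ifs <;> simp_all
  have h0 := e8_charSum_self ha
  have h1 := e8_charSum_self hb
  have h2 := e8_charSum_add hb ha hab
  simp only [sub_mul, mul_add, one_mul, mul_one, Finset.sum_add_distrib, Finset.sum_sub_distrib,
    sum_e8Roots_one, h0, h1, mul_comm (intSign (e8Inner _ a)), h2] at h
  omega

theorem card_e8Roots_odd_even_even {a b c : ℤ} (ha : a ∈ e8Roots) (hb : b ∈ e8Roots)
    (hc : c ∈ e8Roots)
    (hba : Odd (e8Inner b a)) (hca : Odd (e8Inner c a)) (hcb : Even (e8Inner c b)) :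
    24 ≤ (e8Roots.filter fun n =>
      Odd (e8Inner n a) ∧ Even (e8Inner n b) ∧ Even (e8Inner n c)).card := by
  have h : (8 : ℤ) * (e8Roots.filter fun n =>
        Odd (e8Inner n a) ∧ Even (e8Inner n b) ∧ Even (e8Inner n c)).card =
      ∑ n ∈ e8Roots, (1 - intSign (e8Inner n a)) *
        ((1 + intSign (e8Inner n b)) * (1 + intSign (e8Inner n c))) := by
    simp only [one_sub_intSign, one_add_intSign, Finset.card_filter, Nat.cast_sum, Finset.mul_sum]
    exact Finset.sum_congr rfl fun n _ => by split_ifs <;> simp_all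
  have h0 := e8_charSum_self ha
  have h1 := e8_charSum_self hb
  have h2 := e8_charSum_self hc
  have h3 := e8_charSum_add hb ha hba
  have h4 := e8_charSum_add hc ha hca
  have h5 : -16 ≤ ∑ n ∈ e8Roots, intSign (e8Inner n b) * intSign (e8Inner n c) := by
    refine (e8_charSum (e8Vec b + e8Vec c)).1.trans_eq ?_
    simp [Matrix.mulVec_add, intSign_add, e8Inner]
  have h6 : ∑ n ∈ e8Roots,
      intSign (e8Inner n a) * (intSign (e8Inner n b) * intSign (e8Inner n c)) = 16 := by
    rw [← (e8_charSum (e8Vec a + (e8Vec b + e8Vec c))).2]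
    · simp [Matrix.mulVec_add, intSign_add, e8Inner]
    · have g1 := e8Inner_self ha
      have g2 := e8Inner_self hb
      have g3 := e8Inner_self hc
      have g4 := e8Inner_comm a b
      have g5 := e8Inner_comm a c
      have g6 := e8Inner_comm b c
      unfold e8Inner at *
      obtain ⟨k, hk⟩ := hba
      obtain ⟨l, hl⟩ := hca
      obtain ⟨m, hm⟩ := hcb
      simp only [Matrix.mulVec_add, dotProduct_add, add_dotProduct]
      omega
  have e : ∀ x y z : ℤ, (1 - x) * ((1 + y) * (1 + z)) =
      1 - x + y + z - y * x - z * x + y * z - x * (y * z) := fun x y z => by ring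
  simp only [e, Finset.sum_add_distrib, Finset.sum_sub_distrib, sum_e8Roots_one,
    h0, h1, h2, h3, h4, h6] at h
  omega

/-- Quadruples of roots of `E₈`, the first of which has odd inner product with the others, which
have even inner products with each other. -/
@[irreducible]
def e8Stars : Finset (((ℤ × ℤ) × ℤ) × ℤ) :=
  (((e8Roots ×ˢ e8Roots).filter fun x => Odd (e8Inner x.2 x.1)) ×ˢ e8Roots |>.filter fun x =>
    Odd (e8Inner x.2 x.1.1) ∧ Even (e8Inner x.2 x.1.2)) ×ˢ e8Roots |>.filter fun x =>
    Odd (e8Inner x.2 x.1.1.1) ∧ Even (e8Inner x.2 x.1.1.2) ∧ Even (e8Inner x.2 x.1.2)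

/-- There are at least `240 * 112 * 56 * 24` such quadruples. -/
theorem card_e8Stars : 36126720 ≤ e8Stars.card := by
  have h1 := Finset.card_mul_le_card_filter_product (t := e8Roots) (s := e8Roots)
    (P := fun a n => Odd (e8Inner n a)) fun a ha => card_e8Roots_odd ha
  have h2 := Finset.card_mul_le_card_filter_product (t := e8Roots)
    (s := (e8Roots ×ˢ e8Roots).filter fun x => Odd (e8Inner x.2 x.1))
    (P := fun a n => Odd (e8Inner n a.1) ∧ Even (e8Inner n a.2)) fun a ha => by
      simp only [Finset.mem_filter, Finset.mem_product] at ha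
      exact card_e8Roots_odd_even ha.1.1 ha.1.2 ha.2
  have h3 := Finset.card_mul_le_card_filter_product (t := e8Roots)
    (s := ((e8Roots ×ˢ e8Roots).filter fun x => Odd (e8Inner x.2 x.1)) ×ˢ e8Roots |>.filter
      fun x => Odd (e8Inner x.2 x.1.1) ∧ Even (e8Inner x.2 x.1.2))
    (P := fun a n => Odd (e8Inner n a.1.1) ∧ Even (e8Inner n a.1.2) ∧ Even (e8Inner n a.2))
    fun a ha => by
      simp only [Finset.mem_filter, Finset.mem_product] at ha
      exact card_e8Roots_odd_even_even ha.1.1.1.1 ha.1.1.1.2 ha.1.2 ha.1.1.2 ha.2.1 ha.2.2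
  rw [card_e8Roots] at h1
  rw [e8Stars]
  omega

theorem summable_exp_neg_mul_sq {c : ℝ} (hc : 0 < c) :
    Summable fun n : ℤ => Real.exp (-c * (n : ℝ) ^ 2) := by
  have h := summable_pow_mul_jacobiTheta₂_term_bound 0 (T := c / Real.pi) (by positivity) 0
  refine h.congr fun n => ?_
  have : (Real.pi : ℝ) ≠ 0 := Real.pi_ne_zero
  simp
  field_simp

theorem summable_pi_prod {α : Type*} {g : α → ℝ} (hg : Summable g) (h0 : ∀ a, 0 ≤ g a) (n : ℕ) :
    Summable fun x : Fin n → α => ∏ i, g (x i) := by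
  induction n with
  | zero => exact Summable.of_finite
  | succ n ih =>
    rw [← (Fin.consEquiv fun _ => α).summable_iff]
    refine (hg.mul_of_nonneg ih h0 fun x => Finset.prod_nonneg fun i _ => h0 _).congr fun x => ?_
    simp [Fin.prod_univ_succ, Fin.consEquiv]

/-- Integer matrices exhibiting `S` as a positive definite even quadratic form. -/
structure EvenFrame {m : ℕ} (S : Matrix (Fin m) (Fin m) ℤ) where
  B : Matrix (Fin m) (Fin m) ℤ
  C : Matrix (Fin m) (Fin m) ℤ
  P : Matrix (Fin m) (Fin m) ℤ
  transpose_mul : Bᵀ * B = (4 : ℤ) • S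
  mul_eq : C * B = (4 : ℤ) • 1
  eq_add : S = P + Pᵀ

/-- The Gram matrix of the columns of `G`. -/
def colGram {m g : ℕ} (S : Matrix (Fin m) (Fin m) ℤ) (G : Matrix (Fin m) (Fin g) ℤ) :
    Matrix (Fin g) (Fin g) ℤ := Gᵀ * S * G

namespace EvenFrame

variable {m g : ℕ} {S : Matrix (Fin m) (Fin m) ℤ}

theorem mul_injective (F : EvenFrame S) :
    Function.Injective fun G : Matrix (Fin m) (Fin g) ℤ => F.B * G := by
  intro G H h
  have : F.C * (F.B * G) = F.C * (F.B * H) := congrArg _ h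
  rw [← Matrix.mul_assoc, ← Matrix.mul_assoc, F.mul_eq, Matrix.smul_mul, Matrix.smul_mul,
    Matrix.one_mul, Matrix.one_mul] at this
  exact smul_right_injective _ four_ne_zero this

theorem four_smul_colGram (F : EvenFrame S) (G : Matrix (Fin m) (Fin g) ℤ) :
    (4 : ℤ) • colGram S G = (F.B * G)ᵀ * (F.B * G) := by
  rw [Matrix.transpose_mul, Matrix.mul_assoc, ← Matrix.mul_assoc F.Bᵀ, F.transpose_mul, colGram,
    Matrix.smul_mul, Matrix.mul_smul, Matrix.mul_assoc]

theorem four_mul_colGram (F : EvenFrame S) (G : Matrix (Fin m) (Fin g) ℤ) (i j : Fin g) :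
    4 * colGram S G i j = ∑ k, (F.B * G) k i * (F.B * G) k j := by
  have := congrFun (congrFun (F.four_smul_colGram G) i) j
  rwa [Matrix.mul_apply] at this

theorem colGram_eq_add (F : EvenFrame S) (G : Matrix (Fin m) (Fin g) ℤ) :
    colGram S G = Gᵀ * F.P * G + (Gᵀ * F.P * G)ᵀ := by
  conv_lhs => rw [F.eq_add, colGram]
  simp [Matrix.mul_add, Matrix.add_mul, Matrix.mul_assoc]

theorem colGram_symm (F : EvenFrame S) (G : Matrix (Fin m) (Fin g) ℤ) (i j : Fin g) :
    colGram S G i j = colGram S G j i := by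
  rw [F.colGram_eq_add]; exact add_comm _ _

theorem even_colGram (F : EvenFrame S) (G : Matrix (Fin m) (Fin g) ℤ) (i : Fin g) :
    Even (colGram S G i i) := by
  rw [F.colGram_eq_add]; exact ⟨_, rfl⟩

theorem colGram_nonneg (F : EvenFrame S) (G : Matrix (Fin m) (Fin g) ℤ) (i : Fin g) :
    0 ≤ colGram S G i i := by
  have := F.four_mul_colGram G i i
  have : 0 ≤ ∑ k, (F.B * G) k i * (F.B * G) k i := Finset.sum_nonneg fun k _ => mul_self_nonneg _
  omega

theorem summable_exp_trace (F : EvenFrame S) {t : ℝ} (ht : 0 < t) :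
    Summable fun G : Matrix (Fin m) (Fin g) ℤ =>
      Real.exp (-(Real.pi * t) * ((colGram S G).trace : ℤ)) := by
  have h1 := summable_pi_prod (summable_pi_prod
    (summable_exp_neg_mul_sq (c := Real.pi * t / 4) (by positivity))
    (fun _ => (Real.exp_pos _).le) g) (fun _ => Finset.prod_nonneg fun _ _ => (Real.exp_pos _).le) m
  have h2 := h1.comp_injective (F.mul_injective (g := g))
  refine h2.congr fun G => ?_
  have h3 : (4 : ℝ) * ((colGram S G).trace : ℤ) = ∑ k, ∑ i, ((F.B * G) k i : ℝ) ^ 2 := by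
    rw [Finset.sum_comm]
    have : 4 * (colGram S G).trace = ∑ i, ∑ k, ((F.B * G) k i) ^ 2 := by
      simp only [Matrix.trace, Finset.mul_sum, Matrix.diag_apply, F.four_mul_colGram, sq]
    exact_mod_cast this
  simp only [Function.comp, ← Real.exp_sum, ← Finset.mul_sum]
  rw [← h3]
  ring_nf

end EvenFrame

/-- The `(i, j)` entry is odd, respectively congruent to `2` modulo `4` on the diagonal. -/
def OddAt (T : Matrix (Fin 4) (Fin 4) ℤ) (p : Fin 4 × Fin 4) : Prop :=
  if p.1 = p.2 then T p.1 p.2 % 4 = 2 else Odd (T p.1 p.2)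

/-- `T` has the same parities as a Gram matrix of `D₄` whose `0`-th vector is the central one. -/
def IsStar (T : Matrix (Fin 4) (Fin 4) ℤ) : Prop :=
  ∀ p : Fin 4 × Fin 4, OddAt T p ↔ p.1 = p.2 ∨ p.1 = 0 ∨ p.2 = 0

def shiftMat (p : Fin 4 × Fin 4) : Matrix (Fin 4) (Fin 4) ℂ :=
  (if p.1 = p.2 then 1 / 4 else 1 / 2 : ℂ) • (Matrix.single p.1 p.2 1 + Matrix.single p.2 p.1 1)

def tauMat (s : Finset (Fin 4 × Fin 4)) (t : ℝ) : Matrix (Fin 4) (Fin 4) ℂ :=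
  ∑ p ∈ s, shiftMat p + (t * Complex.I) • (1 : Matrix (Fin 4) (Fin 4) ℂ)

theorem shiftMat_im (p : Fin 4 × Fin 4) (i j : Fin 4) : (shiftMat p i j).im = 0 := by
  simp only [shiftMat, Matrix.smul_apply, Matrix.add_apply, Matrix.single_apply]
  split_ifs <;> norm_num

theorem shiftMat_symm (p : Fin 4 × Fin 4) : (shiftMat p).IsSymm := by
  rw [shiftMat, Matrix.IsSymm, Matrix.transpose_smul, Matrix.transpose_add,
    Matrix.transpose_single, Matrix.transpose_single, add_comm]

theorem isSiegel_tauMat (s : Finset (Fin 4 × Fin 4)) {t : ℝ} (ht : 0 < t) :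
    IsSiegel (tauMat s t) := by
  constructor
  · simp [tauMat, Matrix.IsSymm, Matrix.transpose_sum, (shiftMat_symm _).eq]
  · have : (Matrix.of fun i j => (tauMat s t i j).im) = t • (1 : Matrix (Fin 4) (Fin 4) ℝ) := by
      ext i j
      simp only [tauMat, Matrix.of_apply, Matrix.add_apply, Matrix.sum_apply, Complex.add_im,
        Complex.im_sum, shiftMat_im, Finset.sum_const_zero, zero_add, Matrix.smul_apply]
      by_cases h : i = j <;> simp [h, Matrix.one_apply]
    rw [this]
    exact Matrix.PosDef.one.smul ht

open Classical in
theorem exp_trace_shiftMat {T : Matrix (Fin 4) (Fin 4) ℤ} (hs : ∀ i j, T i j = T j i)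
    (he : ∀ i, Even (T i i)) (p : Fin 4 × Fin 4) :
    Complex.exp (Real.pi * Complex.I * (T.map (Int.cast : ℤ → ℂ) * shiftMat p).trace) =
      if OddAt T p then -1 else 1 := by
  obtain ⟨i, j⟩ := p
  have h1 : (T.map (Int.cast : ℤ → ℂ) * shiftMat (i, j)).trace =
      (if i = j then 1 / 4 else 1 / 2) * (2 * (T i j : ℂ)) := by
    rw [shiftMat, Matrix.mul_smul, Matrix.trace_smul, Matrix.mul_add, Matrix.trace_add,
      Matrix.trace_mul_single, Matrix.trace_mul_single, smul_eq_mul]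
    simp [hs j i, two_mul]
  have h2 (n : ℤ) : Complex.exp (Real.pi * Complex.I * n) = if Odd n then -1 else 1 := by
    rw [mul_comm, Complex.exp_int_mul, Complex.exp_pi_mul_I]
    split_ifs with h
    · exact h.neg_one_zpow
    · exact (Int.not_odd_iff_even.1 h).neg_one_zpow
  rw [h1]
  by_cases hij : i = j
  · subst hij
    obtain ⟨k, hk⟩ := he i
    have : OddAt T (i, i) ↔ Odd k := by
      simp only [OddAt, if_true, hk, Int.odd_iff]; omega
    simp only [this, ← h2, if_true, hk]
    congr 1; push_cast; ring
  · have : OddAt T (i, j) ↔ Odd (T i j) := by simp [OddAt, hij]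
    simp only [this, ← h2, hij, if_false]
    congr 1; ring

namespace EvenFrame

variable {m : ℕ} {S : Matrix (Fin m) (Fin m) ℤ}

open Classical in
theorem exp_trace_tauMat (F : EvenFrame S) (s : Finset (Fin 4 × Fin 4)) (t : ℝ)
    (G : Matrix (Fin m) (Fin 4) ℤ) :
    Complex.exp ((Real.pi : ℂ) * Complex.I *
      Matrix.trace ((G.map (Int.cast : ℤ → ℂ))ᵀ * S.map (Int.cast : ℤ → ℂ) *
        G.map (Int.cast : ℤ → ℂ) * tauMat s t)) =
      (Real.exp (-(Real.pi * t) * ((colGram S G).trace : ℤ)) : ℂ) *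
        ∏ p ∈ s, if OddAt (colGram S G) p then -1 else 1 := by
  have h1 : (G.map (Int.cast : ℤ → ℂ))ᵀ * S.map (Int.cast : ℤ → ℂ) * G.map (Int.cast : ℤ → ℂ) =
      (colGram S G).map (Int.cast : ℤ → ℂ) := by
    rw [colGram, ← Matrix.transpose_map]
    have h {a b c : ℕ} (M : Matrix (Fin a) (Fin b) ℤ) (N : Matrix (Fin b) (Fin c) ℤ) :
        (M * N).map (Int.cast : ℤ → ℂ) = M.map Int.cast * N.map Int.cast :=
      Matrix.map_mul (f := Int.castRingHom ℂ)
    rw [h, h]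
    rfl
  have h2 : ((colGram S G).map (Int.cast : ℤ → ℂ)).trace = ((colGram S G).trace : ℤ) := by
    simp [Matrix.trace]
  rw [h1, tauMat, Matrix.mul_add, Matrix.trace_add, Matrix.mul_smul, Matrix.mul_one,
    Matrix.trace_smul, h2, Matrix.mul_sum, Matrix.trace_sum, mul_add, Finset.mul_sum,
    Complex.exp_add, Complex.exp_sum, mul_comm]
  congr 1
  · rw [Complex.ofReal_exp]
    congr 1
    push_cast
    rw [smul_eq_mul]
    linear_combination (Real.pi * t * ((colGram S G).trace : ℤ) : ℂ) * Complex.I_mul_I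
  · exact Finset.prod_congr rfl fun p _ =>
      exp_trace_shiftMat (F.colGram_symm G) (F.even_colGram G) p

end EvenFrame

open Classical in
theorem prod_one_add_sign (T : Matrix (Fin 4) (Fin 4) ℤ) :
    ∏ p : Fin 4 × Fin 4, (1 + (if p.1 = p.2 ∨ p.1 = 0 ∨ p.2 = 0 then -1 else 1 : ℂ) *
      (if OddAt T p then -1 else 1)) = if IsStar T then 2 ^ 16 else 0 := by
  split_ifs with h
  · rw [Finset.prod_congr rfl (g := fun _ => (2 : ℂ))]
    · simp
    · intro p _
      have := h p
      split_ifs <;> first | tauto | norm_num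
  · obtain ⟨p, hp⟩ := not_forall.1 h
    refine Finset.prod_eq_zero (Finset.mem_univ p) ?_
    split_ifs <;> first | tauto | norm_num

/-- The part of the theta series supported on the quadruples of `D₄` parity, normalised by its
leading exponential. -/
def starSum {m : ℕ} (S : Matrix (Fin m) (Fin m) ℤ) (t : ℝ) : ℝ :=
  open Classical in
  ∑' G : Matrix (Fin m) (Fin 4) ℤ, if IsStar (colGram S G) then
    Real.exp (-(Real.pi * t) * (((colGram S G).trace : ℤ) - 8)) else 0

namespace EvenFrame

variable {m : ℕ} {S : Matrix (Fin m) (Fin m) ℤ}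

theorem sum_quadThetaSeries (F : EvenFrame S) {t : ℝ} (ht : 0 < t) :
    ∑ s : Finset (Fin 4 × Fin 4), (∏ p ∈ s, if p.1 = p.2 ∨ p.1 = 0 ∨ p.2 = 0 then -1 else 1 : ℂ) *
      quadThetaSeries m 4 S (tauMat s t) =
    (2 ^ 16 * Real.exp (-(Real.pi * t) * 8) : ℝ) * (starSum S t : ℝ) := by
  classical
  simp only [quadThetaSeries, F.exp_trace_tauMat, ← tsum_mul_left]
  rw [← Summable.tsum_finsetSum, starSum, ← Complex.ofReal_mul, ← tsum_mul_left,
    Complex.ofReal_tsum]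
  · refine tsum_congr fun G => ?_
    have h := prod_one_add_sign (colGram S G)
    rw [Finset.prod_one_add, Finset.powerset_univ] at h
    simp only [Finset.prod_mul_distrib] at h
    simp only [mul_left_comm _ (Complex.ofReal _), ← Finset.mul_sum, h]
    split_ifs
    · rw [mul_assoc, ← Real.exp_add, ← mul_add]
      push_cast
      ring_nf
    · simp
  · intro s _
    refine Summable.mul_left _ ?_
    refine Summable.of_norm_bounded (F.summable_exp_trace (g := 4) ht) fun G => ?_
    rw [norm_mul, Complex.norm_real, Real.norm_of_nonneg (Real.exp_pos _).le, norm_prod,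
      Finset.prod_eq_one, mul_one]
    intro p _
    split_ifs <;> simp

/-- The quadruples of vectors of norm `2` whose Gram matrix has the parities of that of `D₄`. -/
def _root_.starSet {m : ℕ} (S : Matrix (Fin m) (Fin m) ℤ) : Set (Matrix (Fin m) (Fin 4) ℤ) :=
  {G | IsStar (colGram S G) ∧ ∀ i, colGram S G i i = 2}

theorem two_le_colGram (F : EvenFrame S) {G : Matrix (Fin m) (Fin 4) ℤ}
    (h : IsStar (colGram S G)) (i : Fin 4) : 2 ≤ colGram S G i i := by
  have h1 : colGram S G i i % 4 = 2 := by simpa [OddAt] using (h (i, i)).2 (Or.inl rfl)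
  have h2 := F.colGram_nonneg G i
  omega

theorem eight_le_trace (F : EvenFrame S) {G : Matrix (Fin m) (Fin 4) ℤ}
    (h : IsStar (colGram S G)) : 8 ≤ (colGram S G).trace := by
  simp only [Matrix.trace, Matrix.diag_apply, Fin.sum_univ_four]
  linarith [F.two_le_colGram h 0, F.two_le_colGram h 1, F.two_le_colGram h 2,
    F.two_le_colGram h 3]

theorem mem_starSet_iff (F : EvenFrame S) {G : Matrix (Fin m) (Fin 4) ℤ} :
    G ∈ starSet S ↔ IsStar (colGram S G) ∧ (colGram S G).trace = 8 := by
  simp only [starSet, Set.mem_ofPred_eq]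
  refine and_congr_right fun h => ?_
  simp only [Matrix.trace, Matrix.diag_apply, Fin.sum_univ_four, Fin.forall_fin_succ]
  have h0 := F.two_le_colGram h 0
  have h1 := F.two_le_colGram h 1
  have h2 := F.two_le_colGram h 2
  have h3 := F.two_le_colGram h 3
  simp
  omega

theorem finite_starSet (F : EvenFrame S) : (starSet S).Finite := by
  have h := (F.summable_exp_trace (g := 4) one_pos).tendsto_cofinite_zero.eventually
    (gt_mem_nhds (Real.exp_pos (-(Real.pi * 1) * 8)))
  refine Set.Finite.subset h fun G hG => ?_
  have := (F.mem_starSet_iff.1 hG).2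
  simp [this]

open Filter Topology in
theorem tendsto_starSum (F : EvenFrame S) :
    Tendsto (starSum S) atTop (𝓝 ((starSet S).ncard : ℝ)) := by
  classical
  have key : ∑' G : Matrix (Fin m) (Fin 4) ℤ, (if G ∈ starSet S then (1 : ℝ) else 0) =
      (starSet S).ncard := by
    rw [tsum_eq_sum (s := F.finite_starSet.toFinset) (fun G hG => by simpa using hG),
      Set.ncard_eq_toFinset_card _ F.finite_starSet,
      Finset.sum_congr rfl (g := fun _ => (1 : ℝ)) (fun G hG => if_pos (by simpa using hG))]
    simp
  rw [← key]
  refine tendsto_tsum_of_dominated_convergence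
    (bound := fun G => Real.exp (Real.pi * 8) *
      Real.exp (-(Real.pi * 1) * ((colGram S G).trace : ℤ)))
    ((F.summable_exp_trace one_pos).mul_left _) (fun G => ?_) ?_
  · by_cases h : IsStar (colGram S G)
    · have h8 := F.eight_le_trace h
      simp only [F.mem_starSet_iff, h, true_and, if_true]
      split_ifs with h'
      · simp [h']
      · have : (0 : ℝ) < ((colGram S G).trace : ℤ) - 8 := by
          have : 8 < (colGram S G).trace := lt_of_le_of_ne h8 (Ne.symm h')
          exact sub_pos.2 (by exact_mod_cast this)
        refine Real.tendsto_exp_atBot.comp ?_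
        simp only [neg_mul]
        exact tendsto_neg_atTop_atBot.comp
          ((tendsto_id.const_mul_atTop Real.pi_pos).atTop_mul_const this)
    · simp [F.mem_starSet_iff, h]
  · filter_upwards [eventually_ge_atTop 1] with t ht G
    split_ifs with h
    · have h8 : (8 : ℝ) ≤ ((colGram S G).trace : ℤ) := by exact_mod_cast F.eight_le_trace h
      rw [Real.norm_of_nonneg (Real.exp_pos _).le, ← Real.exp_add]
      refine Real.exp_le_exp.2 ?_
      have : Real.pi * 1 * (((colGram S G).trace : ℤ) - 8) ≤
          Real.pi * t * (((colGram S G).trace : ℤ) - 8) := by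
        have := Real.pi_pos
        gcongr
      linarith
    · rw [norm_zero]
      positivity

end EvenFrame

open Filter Topology in
theorem ncard_starSet_eq {m m' : ℕ} {S : Matrix (Fin m) (Fin m) ℤ}
    {S' : Matrix (Fin m') (Fin m') ℤ} (F : EvenFrame S) (F' : EvenFrame S')
    (h : ∀ τ : Matrix (Fin 4) (Fin 4) ℂ, IsSiegel τ →
      quadThetaSeries m 4 S τ = quadThetaSeries m' 4 S' τ) :
    (starSet S).ncard = (starSet S').ncard := by
  have h1 : ∀ t : ℝ, 0 < t → starSum S t = starSum S' t := by
    intro t ht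
    have e := F.sum_quadThetaSeries ht
    simp only [h _ (isSiegel_tauMat _ ht), F'.sum_quadThetaSeries ht] at e
    norm_cast at e
    exact (mul_left_cancel₀ (by positivity) e).symm
  have h2 := F.tendsto_starSum.congr' ((eventually_gt_atTop 0).mono h1)
  exact_mod_cast tendsto_nhds_unique h2 F'.tendsto_starSum

/-- `D₁₆⁺` in its orthonormal coordinates, multiplied by `2`. -/
def d16Frame : EvenFrame D16plusGram where
  B := fun i j => if j = 15 then 1 else if i = 15 then 0 else
    if i = j then (if i = 0 then 4 else 2) else if i.val + 1 = j.val then -2 else 0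
  C := fun i j => if i = 15 then (if j = 15 then 4 else 0) else
    (if i = 0 then 1 else 2) *
      (if j = 15 then (i : ℤ) - 15 else if i ≤ j then 1 else 0)
  P := fun i j => if i < j then D16plusGram i j else if i = j then D16plusGram i j / 2 else 0
  transpose_mul := by decide +kernel
  mul_eq := by decide +kernel
  eq_add := by decide +kernel

/-- `E₈ ⊕ E₈` in its orthonormal coordinates, multiplied by `2`. -/
def e8e8Frame : EvenFrame E8E8Gram :=
  let B : Matrix (Fin 8) (Fin 8) ℤ := !![1, -2, 0, 0, 0, 0, 0, 2; -1, 2, -2, 0, 0, 0, 0, 2;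
    -1, 0, 2, -2, 0, 0, 0, 0; -1, 0, 0, 2, -2, 0, 0, 0; -1, 0, 0, 0, 2, -2, 0, 0;
    -1, 0, 0, 0, 0, 2, -2, 0; -1, 0, 0, 0, 0, 0, 2, 0; 1, 0, 0, 0, 0, 0, 0, 0]
  let C : Matrix (Fin 8) (Fin 8) ℤ := !![0, 0, 0, 0, 0, 0, 0, 4; -1, 1, 1, 1, 1, 1, 1, 7;
    0, 0, 2, 2, 2, 2, 2, 10; 0, 0, 0, 2, 2, 2, 2, 8; 0, 0, 0, 0, 2, 2, 2, 6;
    0, 0, 0, 0, 0, 2, 2, 4; 0, 0, 0, 0, 0, 0, 2, 2; 1, 1, 1, 1, 1, 1, 1, 5]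
  { B := Matrix.reindex finSumFinEquiv finSumFinEquiv (Matrix.fromBlocks B 0 0 B)
    C := Matrix.reindex finSumFinEquiv finSumFinEquiv (Matrix.fromBlocks C 0 0 C)
    P := fun i j => if i < j then E8E8Gram i j else if i = j then E8E8Gram i j / 2 else 0
    transpose_mul := by decide +kernel
    mul_eq := by decide +kernel
    eq_add := by decide +kernel }

/-- The vector `± eₐ ± e_b`. -/
def pairVec (a b : Fin 16) (s : Bool × Bool) : Fin 16 → ℤ :=
  Pi.single a (if s.1 then 1 else -1) + Pi.single b (if s.2 then 1 else -1)

def IsPair (u : Fin 16 → ℤ) (a b : Fin 16) : Prop := a ≠ b ∧ ∃ s, u = pairVec a b s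

theorem IsPair.symm {u : Fin 16 → ℤ} {a b : Fin 16} (h : IsPair u a b) : IsPair u b a := by
  obtain ⟨hab, s, rfl⟩ := h
  exact ⟨hab.symm, s.swap, add_comm _ _⟩

theorem odd_pairVec {a b : Fin 16} (hab : a ≠ b) (s : Bool × Bool) (i : Fin 16) :
    Odd (pairVec a b s i) ↔ i = a ∨ i = b := by
  have h1 : Odd (if s.1 then (1 : ℤ) else -1) := by split_ifs <;> decide
  have h2 : Odd (if s.2 then (1 : ℤ) else -1) := by split_ifs <;> decide
  by_cases ha : i = a
  · subst ha; simp [pairVec, hab, h1]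
  · by_cases hb : i = b
    · subst hb; simp [pairVec, ha, h2]
    · simp [pairVec, ha, hb]

theorem IsPair.odd_dotProduct {u v : Fin 16 → ℤ} {a b c d : Fin 16} (hu : IsPair u a b)
    (hv : IsPair v c d) : Odd (u ⬝ᵥ v) ↔ ((a = c ∨ a = d) ↔ ¬ (b = c ∨ b = d)) := by
  obtain ⟨-, s, rfl⟩ := hu
  obtain ⟨hcd, r, rfl⟩ := hv
  have h1 : Odd (if s.1 then (1 : ℤ) else -1) := by split_ifs <;> decide
  have h2 : Odd (if s.2 then (1 : ℤ) else -1) := by split_ifs <;> decide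
  rw [← odd_pairVec hcd r, ← odd_pairVec hcd r, pairVec, add_dotProduct, single_dotProduct,
    single_dotProduct, Int.odd_add, Int.odd_mul, Int.even_mul, ← Int.not_odd_iff_even,
    ← Int.not_odd_iff_even]
  simp [h1, h2]

theorem exists_isPair {u : Fin 16 → ℤ} (h : ∑ i, u i ^ 2 = 2) : ∃ a b, IsPair u a b := by
  have key : ∀ (s : Finset (Fin 16)) (n : ℤ), 0 < n → n ≤ 2 → ∑ i ∈ s, u i ^ 2 = n →
      ∃ a ∈ s, (u a = 1 ∨ u a = -1) ∧ ∑ i ∈ s.erase a, u i ^ 2 = n - 1 := by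
    intro s n hn hn2 hs
    obtain ⟨a, ha, ha0⟩ := Finset.exists_ne_zero_of_sum_ne_zero (hs.trans_ne hn.ne')
    have h1 := Finset.add_sum_erase s (fun i => u i ^ 2) ha
    have h2 : 0 ≤ ∑ i ∈ s.erase a, u i ^ 2 := Finset.sum_nonneg fun i _ => sq_nonneg _
    have h3 : u a ≠ 0 := fun h => ha0 (by simp [h])
    have h4 : u a = 1 ∨ u a = -1 := by
      have : u a < 2 := by nlinarith
      have : -2 < u a := by nlinarith
      omega
    have h5 : u a ^ 2 = 1 := by rcases h4 with h | h <;> simp [h]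
    exact ⟨a, ha, h4, by linarith⟩
  obtain ⟨a, -, ha, h1⟩ := key _ 2 (by norm_num) le_rfl h
  obtain ⟨b, hb, hb', h2⟩ := key _ _ (by norm_num) (by norm_num) h1
  have hba := (Finset.mem_erase.1 hb).1
  refine ⟨a, b, hba.symm, (decide (u a = 1), decide (u b = 1)), funext fun i => ?_⟩
  by_cases hia : i = a
  · subst hia
    rcases ha with h | h <;> simp [pairVec, hba.symm, h]
  · by_cases hib : i = b
    · subst hib
      rcases hb' with h | h <;> simp [pairVec, hba, h]
    · have := (Finset.sum_eq_zero_iff_of_nonneg fun i _ => sq_nonneg (u i)).1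
        (h2.trans (by norm_num)) i (by simp [hia, hib])
      simpa [pairVec, hia, hib] using this

theorem exists_isPair_common {u v : Fin 16 → ℤ} {a b c d : Fin 16} (hu : IsPair u a b)
    (hv : IsPair v c d) (h : Odd (u ⬝ᵥ v)) :
    ∃ a b c, IsPair u a b ∧ IsPair v a c ∧ b ≠ c := by
  rw [hu.odd_dotProduct hv] at h
  have := hu.1
  by_cases ha : a = c ∨ a = d
  · rcases ha with rfl | rfl
    · exact ⟨_, _, _, hu, hv, by tauto⟩
    · exact ⟨_, _, _, hu, hv.symm, by tauto⟩
  · have hb : b = c ∨ b = d := by tauto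
    rcases hb with rfl | rfl
    · exact ⟨_, _, _, hu.symm, hv, by tauto⟩
    · exact ⟨_, _, _, hu.symm, hv.symm, by tauto⟩

theorem IsPair.eq_or {u v w : Fin 16 → ℤ} {a b c x y : Fin 16} (hu : IsPair u a b)
    (hv : IsPair v a c) (hw : IsPair w x y) (huw : Odd (u ⬝ᵥ w)) (hvw : ¬ Odd (v ⬝ᵥ w)) :
    IsPair w a c ∨ ∃ d, d ≠ a ∧ d ≠ c ∧ IsPair w b d := by
  rw [hu.odd_dotProduct hw] at huw
  rw [hv.odd_dotProduct hw] at hvw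
  have := hu.1
  have := hv.1
  by_cases ha : a = x ∨ a = y
  · rcases ha with rfl | rfl
    · have : c = y := by grind
      exact Or.inl (this ▸ hw)
    · have : c = x := by grind
      exact Or.inl (this ▸ hw.symm)
  · have hb : b = x ∨ b = y := by tauto
    rcases hb with rfl | rfl
    · exact Or.inr ⟨y, by grind, by grind, hw⟩
    · exact Or.inr ⟨x, by grind, by grind, hw.symm⟩

/-- Quadruples of roots of `D₁₆` with the parities of `D₄`, parametrised with repetitions. -/
def d16Star : (Fin 16 × Fin 16 × Fin 16 × Fin 16) × (Bool × Bool) × (Fin 4 → Bool × Bool) →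
    Fin 4 → Fin 16 → ℤ
  | ((a, b, c, d), (e, f), s) =>
    ![pairVec a b (s 0), pairVec a c (s 1), if e then pairVec a c (s 2) else pairVec b d (s 2),
      if f then pairVec a c (s 3) else pairVec b d (s 3)]

theorem mem_range_d16Star {u : Fin 4 → Fin 16 → ℤ} (hu : ∀ j, ∑ i, u j i ^ 2 = 2)
    (h01 : Odd (u 0 ⬝ᵥ u 1)) (h02 : Odd (u 0 ⬝ᵥ u 2)) (h03 : Odd (u 0 ⬝ᵥ u 3))
    (h12 : ¬ Odd (u 1 ⬝ᵥ u 2)) (h13 : ¬ Odd (u 1 ⬝ᵥ u 3)) (h23 : ¬ Odd (u 2 ⬝ᵥ u 3)) :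
    u ∈ Set.range d16Star := by
  obtain ⟨_, _, h0⟩ := exists_isPair (hu 0)
  obtain ⟨_, _, h1⟩ := exists_isPair (hu 1)
  obtain ⟨_, _, h2⟩ := exists_isPair (hu 2)
  obtain ⟨_, _, h3⟩ := exists_isPair (hu 3)
  obtain ⟨a, b, c, h0, h1, hbc⟩ := exists_isPair_common h0 h1 h01
  obtain ⟨-, s0, e0⟩ := id h0
  obtain ⟨-, s1, e1⟩ := id h1
  have hu : u = ![u 0, u 1, u 2, u 3] := by ext i; fin_cases i <;> rfl
  rw [hu]
  rcases h0.eq_or h1 h2 h02 h12 with ⟨-, s2, e2⟩ | ⟨d, hda, hdc, h2'⟩ <;>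
  rcases h0.eq_or h1 h3 h03 h13 with ⟨-, s3, e3⟩ | ⟨d', hda', hdc', h3'⟩
  · exact ⟨((a, b, c, a), (true, true), ![s0, s1, s2, s3]), by simp [d16Star, e0, e1, e2, e3]⟩
  · obtain ⟨-, s3, e3⟩ := h3'
    exact ⟨((a, b, c, d'), (true, false), ![s0, s1, s2, s3]), by simp [d16Star, e0, e1, e2, e3]⟩
  · obtain ⟨-, s2, e2⟩ := h2'
    exact ⟨((a, b, c, d), (false, true), ![s0, s1, s2, s3]), by simp [d16Star, e0, e1, e2, e3]⟩
  · rw [h2'.odd_dotProduct h3'] at h23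
    obtain ⟨hbd, s2, e2⟩ := h2'
    obtain ⟨hbd', s3, e3⟩ := h3'
    obtain rfl : d = d' := by grind
    exact ⟨((a, b, c, d), (false, false), ![s0, s1, s2, s3]), by simp [d16Star, e0, e1, e2, e3]⟩

theorem even_d16Frame_mul {G : Matrix (Fin 16) (Fin 4) ℤ} {j : Fin 4}
    (h : colGram D16plusGram G j j = 2) (i : Fin 16) : Even ((d16Frame.B * G) i j) := by
  have h1 : ∀ i k : Fin 16,
      d16Frame.B i k = (if k = 15 then 1 else 0 : ℤ) + 2 * (d16Frame.B i k / 2) := by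
    have h15 : ∀ i k : Fin 16, d16Frame.B i k % 2 = if k = 15 then 1 else 0 := by
      decide +kernel
    intro i k
    rw [← h15 i]
    omega
  have h2 : ∀ i, (d16Frame.B * G) i j = G 15 j + 2 * ∑ k, d16Frame.B i k / 2 * G k j := by
    intro i
    rw [Matrix.mul_apply, Finset.sum_congr rfl fun k _ => congrArg (· * G k j) (h1 i k)]
    simp [add_mul, Finset.sum_add_distrib, Finset.mul_sum, mul_assoc]
  have h3 := d16Frame.four_mul_colGram G j j
  rw [h2]
  refine Even.add ?_ (even_two_mul _)
  by_contra hodd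
  have h4 : ∀ k, 1 ≤ (d16Frame.B * G) k j * (d16Frame.B * G) k j := by
    intro k
    have : (d16Frame.B * G) k j ≠ 0 := by
      rw [h2]
      intro h0
      rw [Int.not_even_iff_odd] at hodd
      obtain ⟨z, hz⟩ := hodd
      omega
    exact lt_of_le_of_ne (mul_self_nonneg _) (mul_self_ne_zero.2 this).symm
  have := Finset.sum_le_sum fun k (_ : k ∈ Finset.univ) => h4 k
  rw [← h3, h] at this
  simp at this

theorem ncard_starSet_d16_le : (starSet D16plusGram).ncard ≤ 2 ^ 26 := by
  let f : Matrix (Fin 16) (Fin 4) ℤ → Fin 4 → Fin 16 → ℤ := fun G j i => (d16Frame.B * G) i j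
  have hf : Function.Injective f := fun G H h => d16Frame.mul_injective <| by
    ext i j
    exact congrFun (congrFun h j) i
  have hsub : Set.image f (starSet D16plusGram) ⊆ Set.range fun x => (2 : ℤ) • d16Star x := by
    rintro _ ⟨G, ⟨hG, hG2⟩, rfl⟩
    choose u hu using fun j i => even_d16Frame_mul (hG2 j) i
    have hdot : ∀ i j, u i ⬝ᵥ u j = colGram D16plusGram G i j := by
      intro i j
      have := d16Frame.four_mul_colGram G i j
      have e : ∀ x, 2 * u i x * (2 * u j x) = 4 * (u i x * u j x) := fun x => by ring
      simp only [hu, ← two_mul, e, ← Finset.mul_sum] at this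
      rw [dotProduct]
      linarith
    have hodd : ∀ i j, i ≠ j → (Odd (u i ⬝ᵥ u j) ↔ i = 0 ∨ j = 0) := by
      intro i j hij
      simpa [OddAt, hij, hdot] using hG (i, j)
    obtain ⟨x, hx⟩ : u ∈ Set.range d16Star := by
      refine mem_range_d16Star (fun j => ?_) ?_ ?_ ?_ ?_ ?_ ?_
      · have := hdot j j
        rw [hG2 j, dotProduct] at this
        simpa [sq] using this
      all_goals rw [hodd _ _ (by decide)]; decide
    refine ⟨x, ?_⟩
    ext j i
    simp [f, hx, hu, two_mul]
  calc (starSet D16plusGram).ncard = (Set.image f (starSet D16plusGram)).ncard :=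
        (Set.ncard_image_of_injective _ hf).symm
    _ ≤ (Set.range fun x => (2 : ℤ) • d16Star x).ncard :=
        Set.ncard_le_ncard hsub (Set.finite_range _)
    _ ≤ Nat.card ((Fin 16 × Fin 16 × Fin 16 × Fin 16) × (Bool × Bool) × (Fin 4 → Bool × Bool)) := by
        rw [← Set.image_univ, ← Set.ncard_univ]
        exact Set.ncard_image_le Set.finite_univ
    _ = 2 ^ 26 := by simp

/-- The `8 × 4` matrix whose columns are the given four roots of `E₈`. -/
def e8Cols (x : ((ℤ × ℤ) × ℤ) × ℤ) : Matrix (Fin 8) (Fin 4) ℤ :=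
  fun i j => e8Vec (![x.1.1.1, x.1.1.2, x.1.2, x.2] j) i

/-- Four vectors of one of the two summands of `E₈ ⊕ E₈`. -/
def e8Embed (c : Bool) (A : Matrix (Fin 8) (Fin 4) ℤ) : Matrix (Fin 16) (Fin 4) ℤ :=
  (if c then Matrix.fromRows A 0 else Matrix.fromRows 0 A).submatrix
    (finSumFinEquiv (m := 8) (n := 8)).symm id

theorem colGram_e8Embed (c : Bool) (A : Matrix (Fin 8) (Fin 4) ℤ) :
    colGram E8E8Gram (e8Embed c A) = colGram E8Gram A := by
  have h : ∀ M : Matrix (Fin 8 ⊕ Fin 8) (Fin 4) ℤ,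
      colGram E8E8Gram (M.submatrix (finSumFinEquiv (m := 8) (n := 8)).symm id) =
        Mᵀ * Matrix.fromBlocks E8Gram 0 0 E8Gram * M := by
    intro M
    rw [colGram, E8E8Gram, Matrix.reindex_apply, Matrix.transpose_submatrix,
      Matrix.submatrix_mul_equiv, Matrix.submatrix_mul_equiv, Matrix.submatrix_id_id]
  rw [e8Embed, h, colGram]
  cases c <;>
    simp [Matrix.mul_assoc, Matrix.fromBlocks_mul_fromRows, Matrix.transpose_fromRows,
      Matrix.fromCols_mul_fromRows]

theorem colGram_e8Cols (x : ((ℤ × ℤ) × ℤ) × ℤ) (i j : Fin 4) :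
    colGram E8Gram (e8Cols x) i j =
      e8Inner (![x.1.1.1, x.1.1.2, x.1.2, x.2] i) (![x.1.1.1, x.1.1.2, x.1.2, x.2] j) := by
  rw [colGram, Matrix.mul_assoc]
  rfl

theorem e8Embed_mem_starSet {x : ((ℤ × ℤ) × ℤ) × ℤ} (hx : x ∈ e8Stars) (c : Bool) :
    e8Embed c (e8Cols x) ∈ starSet E8E8Gram := by
  obtain ⟨⟨⟨a, b⟩, d⟩, e⟩ := x
  simp only [e8Stars, Finset.mem_filter, Finset.mem_product] at hx
  obtain ⟨⟨⟨⟨⟨⟨ha, hb⟩, hba⟩, hd⟩, hda, hdb⟩, he⟩, hea, heb, hed⟩ := hx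
  have hdiag : ∀ i, colGram E8Gram (e8Cols (((a, b), d), e)) i i = 2 := by
    intro i
    rw [colGram_e8Cols]
    fin_cases i
    exacts [e8Inner_self ha, e8Inner_self hb, e8Inner_self hd, e8Inner_self he]
  rw [starSet, Set.mem_ofPred_eq, colGram_e8Embed]
  refine ⟨fun p => ?_, hdiag⟩
  obtain ⟨i, j⟩ := p
  by_cases hij : i = j
  · subst hij
    simp [OddAt, hdiag]
  · have hab := e8Inner_comm a b ▸ hba
    have had := e8Inner_comm a d ▸ hda
    have hae := e8Inner_comm a e ▸ hea
    have hbd := e8Inner_comm b d ▸ hdb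
    have hbe := e8Inner_comm b e ▸ heb
    have hde := e8Inner_comm d e ▸ hed
    simp only [OddAt, hij, if_false, colGram_e8Cols, false_or]
    fin_cases i <;> fin_cases j <;> simp_all

theorem e8Vec_injOn : Set.InjOn e8Vec e8Roots := by
  intro m hm n hn h
  rw [← sum_pow_mul_e8Vec m (mem_e8Roots.1 hm), h, sum_pow_mul_e8Vec n (mem_e8Roots.1 hn)]

theorem e8Embed_e8Cols_injOn :
    Set.InjOn (fun y : Bool × (((ℤ × ℤ) × ℤ) × ℤ) => e8Embed y.1 (e8Cols y.2))
      {y | y.2 ∈ e8Stars} := by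
  have hz : ∀ n ∈ e8Roots, e8Vec n ≠ 0 := by
    intro n hn h0
    have := e8Inner_self hn
    simp [e8Inner, h0] at this
  have hl : ∀ c A (i : Fin 8) j,
      e8Embed c A (Fin.castAdd 8 i : Fin (8 + 8)) j = if c then A i j else 0 := by
    intro c A i j
    rw [e8Embed, Matrix.submatrix_apply, finSumFinEquiv_symm_apply_castAdd]
    cases c <;> rfl
  have hr : ∀ c A (i : Fin 8) j,
      e8Embed c A (Fin.natAdd 8 i : Fin (8 + 8)) j = if c then 0 else A i j := by
    intro c A i j
    rw [e8Embed, Matrix.submatrix_apply, finSumFinEquiv_symm_apply_natAdd]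
    cases c <;> rfl
  rintro ⟨c, ⟨⟨a, b⟩, d⟩, e⟩ hx ⟨c', ⟨⟨a', b'⟩, d'⟩, e'⟩ hx' h
  simp only [Set.mem_ofPred_eq, e8Stars, Finset.mem_filter, Finset.mem_product] at hx hx'
  obtain ⟨⟨⟨⟨⟨⟨ha, hb⟩, -⟩, hd⟩, -⟩, he⟩, -⟩ := hx
  obtain ⟨⟨⟨⟨⟨⟨ha', hb'⟩, -⟩, hd'⟩, -⟩, he'⟩, -⟩ := hx'
  have h1 := fun (i : Fin 8) j => congrFun (congrFun h (Fin.castAdd 8 i : Fin (8 + 8))) j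
  have h2 := fun (i : Fin 8) j => congrFun (congrFun h (Fin.natAdd 8 i : Fin (8 + 8))) j
  simp only [hl, hr] at h1 h2
  obtain rfl : c = c' := by
    by_contra hc
    cases c <;> cases c' <;> try exact hc rfl
    · exact hz a ha (funext fun i => by simpa [e8Cols] using h2 i 0)
    · exact hz a ha (funext fun i => by simpa [e8Cols] using h1 i 0)
  have h3 : e8Cols (((a, b), d), e) = e8Cols (((a', b'), d'), e') := by
    ext i j
    cases c
    · simpa using h2 i j
    · simpa using h1 i j
  have h4 := fun j => funext fun i => congrFun (congrFun h3 i) j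
  rw [e8Vec_injOn ha ha' (h4 0), e8Vec_injOn hb hb' (h4 1), e8Vec_injOn hd hd' (h4 2),
    e8Vec_injOn he he' (h4 3)]

theorem two_mul_card_le_ncard_starSet_e8e8 {T : Finset (((ℤ × ℤ) × ℤ) × ℤ)}
    (hT : ∀ x ∈ T, x ∈ e8Stars) : 2 * T.card ≤ (starSet E8E8Gram).ncard := by
  have h := Set.ncard_le_ncard (s := Set.image (fun y : Bool × (((ℤ × ℤ) × ℤ) × ℤ) =>
      e8Embed y.1 (e8Cols y.2)) ((Finset.univ : Finset Bool) ×ˢ T : Finset _))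
    (t := starSet E8E8Gram) (by
      rintro _ ⟨⟨c, x⟩, hx, rfl⟩
      exact e8Embed_mem_starSet (hT x (Finset.mem_product.1 hx).2) c) e8e8Frame.finite_starSet
  rw [Set.InjOn.ncard_image, Set.ncard_coe_finset, Finset.card_product] at h
  · exact h
  · exact e8Embed_e8Cols_injOn.mono fun y hy => hT _ (Finset.mem_product.1 hy).2

theorem le_ncard_starSet_e8e8 : 72253440 ≤ (starSet E8E8Gram).ncard :=
  (Nat.mul_le_mul_left 2 card_e8Stars).trans (two_mul_card_le_ncard_starSet_e8e8 fun _ hx => hx)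

/-- The Schottky–Igusa modular form
`F(τ) = θ^{(4)}_{S(8)⊕S(8)}(τ) − θ^{(4)}_{S(16)}(τ)` is not identically zero on `ℍ_4`. -/
theorem schottky_form_ne_zero :
    ∃ τ : Matrix (Fin 4) (Fin 4) ℂ, IsSiegel τ ∧
      quadThetaSeries 16 4 E8E8Gram τ - quadThetaSeries 16 4 D16plusGram τ ≠ 0 := by
  by_contra! h
  have h1 := ncard_starSet_eq e8e8Frame d16Frame fun τ hτ => sub_eq_zero.1 (h τ hτ)
  have h2 := le_ncard_starSet_e8e8
  have h3 := ncard_starSet_d16_le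
  norm_num at h3
  omega
end
end
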